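/- arXiv:2309.08331 — 2 statements merged into one kernel-verified Lean document; each statement's English description precedes it below -/
import Mathlib

section
/- Let m ≥ 1, let W be a real vector space and V a real normed vector space. Let f_1, …, f_m : W → V be linear maps, w_1, …, w_m ∈ W, and c_1, …, c_m positive real numbers such that for every index j one has ‖f_j(w_j)‖ > (1 − 1/m) · c_j, and for all indices j ≠ k one has ‖f_k(w_j)‖ < c_j / m. Then the linear maps f_1, …, f_m are linearly independent over ℝ in the space of linear maps from W to V. -/
/-- Linear maps are linearly independent if each `f j` dominates, at some test vector `w j`,
the sum of the norms of all the other maps. -/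
theorem linearIndependent_of_sum_norm_lt {ι W V : Type*} [Fintype ι] [DecidableEq ι]
    [AddCommGroup W] [Module ℝ W] [NormedAddCommGroup V] [NormedSpace ℝ V]
    (f : ι → W →ₗ[ℝ] V) (w : ι → W)
    (h : ∀ j, ∑ k ∈ Finset.univ.erase j, ‖f k (w j)‖ < ‖f j (w j)‖) :
    LinearIndependent ℝ f := by
  rw [Fintype.linearIndependent_iff]
  intro s hs i
  obtain ⟨j, -, hj⟩ := Finset.exists_max_image Finset.univ (fun k => |s k|) ⟨i, Finset.mem_univ i⟩
  suffices hsj : |s j| ≤ 0 from abs_nonpos_iff.mp ((hj i (Finset.mem_univ i)).trans hsj)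
  by_contra! hpos
  have hw : ∑ k, s k • f k (w j) = 0 := by
    simpa using congrArg (fun g : W →ₗ[ℝ] V => g (w j)) hs
  rw [← Finset.add_sum_erase _ _ (Finset.mem_univ j)] at hw
  have hle : |s j| * ‖f j (w j)‖ ≤ |s j| * ∑ k ∈ Finset.univ.erase j, ‖f k (w j)‖ :=
    calc |s j| * ‖f j (w j)‖ = ‖∑ k ∈ Finset.univ.erase j, s k • f k (w j)‖ := by
          rw [← Real.norm_eq_abs, ← norm_smul, eq_neg_of_add_eq_zero_left hw, norm_neg]
      _ ≤ ∑ k ∈ Finset.univ.erase j, |s j| * ‖f k (w j)‖ := by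
          refine norm_sum_le_of_le _ fun k _ => ?_
          rw [norm_smul, Real.norm_eq_abs]
          exact mul_le_mul_of_nonneg_right (hj k (Finset.mem_univ k)) (norm_nonneg _)
      _ = |s j| * ∑ k ∈ Finset.univ.erase j, ‖f k (w j)‖ := (Finset.mul_sum ..).symm
  exact (h j).not_ge (le_of_mul_le_mul_left hle hpos)

/-- Quantitative linear-independence criterion from the proof of Lemma 3.10:
if `‖f j (w j)‖ > (1 - 1/m) * c j` for all `j`, and `‖f k (w j)‖ < c j / m` for all
`j ≠ k`, then the linear maps `f 1, …, f m` are linearly independent over `ℝ`. -/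
theorem linearIndependent_of_norm_estimates
    {m : ℕ} (hm : 1 ≤ m)
    {W V : Type*} [AddCommGroup W] [Module ℝ W]
    [NormedAddCommGroup V] [NormedSpace ℝ V]
    (f : Fin m → W →ₗ[ℝ] V) (w : Fin m → W) (c : Fin m → ℝ)
    (hc : ∀ j, 0 < c j)
    (h1 : ∀ j, ‖f j (w j)‖ > (1 - 1 / (m : ℝ)) * c j)
    (h2 : ∀ j k, j ≠ k → ‖f k (w j)‖ < c j / (m : ℝ)) :
    LinearIndependent ℝ f := by
  refine linearIndependent_of_sum_norm_lt f w fun j => ?_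
  have hm0 : (m : ℝ) ≠ 0 := by positivity
  calc ∑ k ∈ Finset.univ.erase j, ‖f k (w j)‖
      ≤ ∑ _k ∈ Finset.univ.erase j, c j / (m : ℝ) :=
        Finset.sum_le_sum fun k hk => (h2 j k (Finset.ne_of_mem_erase hk).symm).le
    _ = (1 - 1 / (m : ℝ)) * c j := by
        rw [Finset.sum_const, Finset.card_erase_of_mem (Finset.mem_univ j), Finset.card_univ,
          Fintype.card_fin, nsmul_eq_mul, Nat.cast_sub hm]
        field_simp
        rw [Nat.cast_one]
        ring
    _ < ‖f j (w j)‖ := h1 j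
end

section
/- Let p ≥ q ≥ 1 be integers, and index complex square matrices of size p+q by the type Fin q ⊕ Fin (p−q) ⊕ Fin q (three blocks of sizes q, p−q, q). Define B to be the matrix whose (1,3) and (3,1) blocks are the anti-diagonal q×q matrix I′_q (with (i,j) entry equal to 1 exactly when i + j = q − 1 in 0-based indexing, and 0 otherwise), whose (2,2) block is the identity matrix of size p−q, and all other blocks zero. Define h to be the block-diagonal matrix diag(I_q, 0, −I_q); define e to be √−1 times the matrix whose (1,3) block is the identity I_q and all other blocks zero; and define f to be the conjugate transpose of e, i.e., −√−1 times the matrix whose (3,1) block is I_q and all other blocks zero. Then: (a) h·e − e·h = 2 • e, h·f − f·h = (−2) • f, and e·f − f·e = h; and (b) each of the matrices Z ∈ {h, e, f} satisfies trace(Z) = 0 and Zᴴ·B + B·Z = 0, where Zᴴ denotes the conjugate transpose. -/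
open Matrix

/-- The index type for block matrices of size `p + q`, split into blocks of
sizes `q`, `p - q`, `q`. -/
abbrev BlockIdx (p q : ℕ) := Fin q ⊕ Fin (p - q) ⊕ Fin q

/-- The matrix `B_{p,q}`: anti-diagonal `q × q` matrix `I'_q` in the `(1,3)` and `(3,1)`
blocks, identity in the `(2,2)` block, zero elsewhere. It defines a Hermitian form of
signature `(p,q)` on `ℂ^{p+q}`. -/
def Bpq (p q : ℕ) : Matrix (BlockIdx p q) (BlockIdx p q) ℂ :=
  Matrix.of fun i j =>
    match i, j with
    | Sum.inl i, Sum.inr (Sum.inr j) => if (i : ℕ) + (j : ℕ) = q - 1 then 1 else 0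
    | Sum.inr (Sum.inr i), Sum.inl j => if (i : ℕ) + (j : ℕ) = q - 1 then 1 else 0
    | Sum.inr (Sum.inl i), Sum.inr (Sum.inl j) => if i = j then 1 else 0
    | _, _ => 0

/-- The matrix `h = diag(I_q, 0, -I_q)`. -/
def hMat (p q : ℕ) : Matrix (BlockIdx p q) (BlockIdx p q) ℂ :=
  Matrix.of fun i j =>
    match i, j with
    | Sum.inl i, Sum.inl j => if i = j then 1 else 0
    | Sum.inr (Sum.inr i), Sum.inr (Sum.inr j) => if i = j then -1 else 0
    | _, _ => 0

/-- The matrix `e`: `√-1` times the matrix whose `(1,3)` block is `I_q`, zero elsewhere. -/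
def eMat (p q : ℕ) : Matrix (BlockIdx p q) (BlockIdx p q) ℂ :=
  Matrix.of fun i j =>
    match i, j with
    | Sum.inl i, Sum.inr (Sum.inr j) => if i = j then Complex.I else 0
    | _, _ => 0

/-- The matrix `f = eᴴ`, the conjugate transpose of `e`; equivalently `-√-1` times the
matrix whose `(3,1)` block is `I_q`, zero elsewhere. -/
def fMat (p q : ℕ) : Matrix (BlockIdx p q) (BlockIdx p q) ℂ :=
  (eMat p q)ᴴ

/-- The anti-diagonal `q × q` permutation matrix. -/
def antiDiag (q : ℕ) : Matrix (Fin q) (Fin q) ℂ :=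
  Matrix.of fun i j => if (i : ℕ) + (j : ℕ) = q - 1 then 1 else 0

theorem Bpq_eq_fromBlocks (p q : ℕ) :
    Bpq p q = fromBlocks 0 (fromCols 0 (antiDiag q)) (fromRows 0 (antiDiag q))
      (fromBlocks 1 0 0 0) := by
  ext (i | i | i) (j | j | j) <;> simp [Bpq, antiDiag, one_apply]

theorem hMat_eq_fromBlocks (p q : ℕ) :
    hMat p q = fromBlocks 1 0 0 (fromBlocks 0 0 0 (-1)) := by
  ext (i | i | i) (j | j | j) <;> simp [hMat, one_apply]
  split_ifs <;> simp

theorem eMat_eq_fromBlocks (p q : ℕ) :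
    eMat p q = fromBlocks 0 (fromCols 0 (Complex.I • 1)) 0 0 := by
  ext (i | i | i) (j | j | j) <;> simp [eMat, one_apply]

theorem fMat_eq_fromBlocks (p q : ℕ) :
    fMat p q = fromBlocks 0 0 (fromRows 0 (-Complex.I • 1)) 0 := by
  ext (i | i | i) (j | j | j) <;>
    simp [fMat, eMat, one_apply, eq_comm, apply_ite (starRingEnd ℂ)]
  split_ifs <;> simp

theorem conjTranspose_hMat (p q : ℕ) : (hMat p q)ᴴ = hMat p q := by
  simp [hMat_eq_fromBlocks, fromBlocks_conjTranspose]

theorem conjTranspose_fMat (p q : ℕ) : (fMat p q)ᴴ = eMat p q :=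
  conjTranspose_conjTranspose _

theorem hMat_mul_eMat (p q : ℕ) : hMat p q * eMat p q = eMat p q := by
  simp [hMat_eq_fromBlocks, eMat_eq_fromBlocks, fromBlocks_multiply]

theorem eMat_mul_hMat (p q : ℕ) : eMat p q * hMat p q = -eMat p q := by
  ext (i | i | i) (j | j | j) <;>
    simp [hMat_eq_fromBlocks, eMat_eq_fromBlocks, fromBlocks_multiply,
      fromCols_mul_fromBlocks]

theorem hMat_mul_fMat (p q : ℕ) : hMat p q * fMat p q = -fMat p q := by
  simpa [conjTranspose_mul, conjTranspose_hMat, fMat] using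
    congrArg conjTranspose (eMat_mul_hMat p q)

theorem fMat_mul_hMat (p q : ℕ) : fMat p q * hMat p q = fMat p q := by
  simpa [conjTranspose_mul, conjTranspose_hMat, fMat] using
    congrArg conjTranspose (hMat_mul_eMat p q)

theorem eMat_mul_fMat_sub (p q : ℕ) :
    eMat p q * fMat p q - fMat p q * eMat p q = hMat p q := by
  ext (i | i | i) (j | j | j) <;>
    simp [hMat_eq_fromBlocks, eMat_eq_fromBlocks, fMat_eq_fromBlocks, fromBlocks_multiply,
      fromCols_mul_fromRows, smul_smul, ← mul_assoc]

theorem hMat_mul_Bpq_add (p q : ℕ) : hMat p q * Bpq p q + Bpq p q * hMat p q = 0 := by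
  ext (i | i | i) (j | j | j) <;>
    simp [hMat_eq_fromBlocks, Bpq_eq_fromBlocks, fromBlocks_multiply,
      fromCols_mul_fromBlocks, fromBlocks_mul_fromRows]

theorem fMat_mul_Bpq_add (p q : ℕ) : fMat p q * Bpq p q + Bpq p q * eMat p q = 0 := by
  ext (i | i | i) (j | j | j) <;>
    simp [eMat_eq_fromBlocks, fMat_eq_fromBlocks, Bpq_eq_fromBlocks, fromBlocks_multiply]

theorem eMat_mul_Bpq_add (p q : ℕ) : eMat p q * Bpq p q + Bpq p q * fMat p q = 0 := by
  ext (i | i | i) (j | j | j) <;>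
    simp [eMat_eq_fromBlocks, fMat_eq_fromBlocks, Bpq_eq_fromBlocks, fromBlocks_multiply,
      fromCols_mul_fromRows, fromCols_mul_fromBlocks, fromBlocks_mul_fromRows]

/-- Verification for the homomorphism `ρ₁` of Section 6 of the paper:
(a) `(h, e, f)` is an `𝔰𝔩₂`-triple, and moreover `f` is as described explicitly;
(b) `h`, `e`, `f` are trace-free and satisfy `Zᴴ B + B Z = 0`, i.e. they lie in
`𝔰𝔲(p,q)`. -/
theorem su_pq_sl2_triple (p q : ℕ) (hq : 1 ≤ q) (hpq : q ≤ p) :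
    (fMat p q = Matrix.of fun i j =>
      match i, j with
      | Sum.inr (Sum.inr i), Sum.inl j => if i = j then -Complex.I else 0
      | _, _ => 0) ∧
    (hMat p q * eMat p q - eMat p q * hMat p q = (2 : ℂ) • eMat p q ∧
     hMat p q * fMat p q - fMat p q * hMat p q = (-2 : ℂ) • fMat p q ∧
     eMat p q * fMat p q - fMat p q * eMat p q = hMat p q) ∧
    (∀ Z ∈ ({hMat p q, eMat p q, fMat p q} :
        Set (Matrix (BlockIdx p q) (BlockIdx p q) ℂ)),
      Z.trace = 0 ∧ Zᴴ * Bpq p q + Bpq p q * Z = 0) := by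
  refine ⟨?_, ⟨?_, ?_, eMat_mul_fMat_sub p q⟩, ?_⟩
  · ext (i | i | i) (j | j | j) <;>
      simp [fMat, eMat, eq_comm, apply_ite (starRingEnd ℂ)]
  · rw [hMat_mul_eMat, eMat_mul_hMat]
    module
  · rw [hMat_mul_fMat, fMat_mul_hMat]
    module
  · rintro Z (rfl | rfl | rfl)
    · refine ⟨by simp [hMat, trace], ?_⟩
      rw [conjTranspose_hMat, hMat_mul_Bpq_add]
    · exact ⟨by simp [eMat, trace], fMat_mul_Bpq_add p q⟩
    · refine ⟨by simp [fMat_eq_fromBlocks, trace], ?_⟩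
      rw [conjTranspose_fMat, eMat_mul_Bpq_add]
end
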